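/- arXiv:math/0602277 — 8 statements merged into one kernel-verified Lean document; each statement's English description precedes it below -/
import Mathlib

section
/- Let F be an infinite field of characteristic different from 2, let n ≥ 1, and let M be a linear subspace of the space of symmetric n × n matrices over F such that every matrix in M is singular (has determinant zero). Then there exists a nonzero vector v ∈ Fⁿ such that vᵀ A v = 0 for every A ∈ M. -/
open Matrix

/-- An injective linear map on a finite-dimensional space over an infinite field stays injective
under some nonzero perturbation in any given direction. -/
theorem LinearMap.exists_ne_zero_injective_add_smul {F V W : Type*} [Field F] [Infinite F]
    [AddCommGroup V] [Module F V] [FiniteDimensional F V] [AddCommGroup W] [Module F W]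
    (f g : V →ₗ[F] W) (hf : Function.Injective f) :
    ∃ t : F, t ≠ 0 ∧ Function.Injective (f + t • g) := by
  obtain ⟨l, hl⟩ := f.exists_leftInverse_of_injective (LinearMap.ker_eq_bot.mpr hf)
  obtain ⟨s, hs⟩ :=
    ((Module.End.finite_hasEigenvalue (l ∘ₗ g)).union (Set.finite_singleton 0)).exists_notMem
  simp only [Set.mem_union, Set.mem_singleton_iff, not_or] at hs
  obtain ⟨hs_eigen, hs_ne⟩ := hs
  refine ⟨-s⁻¹, neg_ne_zero.mpr (inv_ne_zero hs_ne), ?_⟩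
  rw [injective_iff_map_eq_zero]
  intro x hx
  by_contra hx_ne
  refine hs_eigen (Module.End.hasEigenvalue_of_hasEigenvector (x := x)
    ⟨Module.End.mem_eigenspace_iff.mpr ?_, hx_ne⟩)
  have hlf : l (f x) = x := LinearMap.congr_fun hl x
  have hlx := congrArg l hx
  rw [LinearMap.add_apply, LinearMap.smul_apply, map_add, map_smul, map_zero, hlf, neg_smul,
    add_neg_eq_zero] at hlx
  rw [LinearMap.comp_apply]
  nth_rewrite 2 [hlx]
  rw [smul_inv_smul₀ hs_ne]

/-- If no perturbation `A + t • B` has larger rank than `A`, then `B` maps the kernel of `A` into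
the range of `A`. -/
theorem LinearMap.mem_range_of_forall_finrank_range_add_smul_le {F V W : Type*} [Field F]
    [Infinite F] [AddCommGroup V] [Module F V] [FiniteDimensional F V] [AddCommGroup W]
    [Module F W] (A B : V →ₗ[F] W)
    (hrank : ∀ t : F, Module.finrank F (LinearMap.range (A + t • B)) ≤
      Module.finrank F (LinearMap.range A))
    {v : V} (hv : A v = 0) : B v ∈ LinearMap.range A := by
  by_contra hBv
  obtain ⟨s, hs⟩ := A.rangeRestrict.exists_rightInverse_of_surjective A.range_rangeRestrict
  have hAs (y : LinearMap.range A) : A (s y) = y :=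
    congrArg Subtype.val (LinearMap.congr_fun hs y)
  let f : LinearMap.range A × F →ₗ[F] W :=
    (LinearMap.range A).subtype.coprod (LinearMap.toSpanSingleton F W (B v))
  let g : LinearMap.range A × F →ₗ[F] W := B ∘ₗ s ∘ₗ LinearMap.fst F _ F
  have hf : Function.Injective f := by
    rw [injective_iff_map_eq_zero]
    rintro ⟨y, c⟩ hyc
    have hyc' : (y : W) + c • B v = 0 := by simpa [f] using hyc
    have hc : c = 0 := by
      by_contra hc
      refine hBv (((LinearMap.range A).smul_mem_iff hc).mp ?_)
      rw [← neg_eq_of_add_eq_zero_right hyc']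
      exact neg_mem y.2
    subst hc
    simpa using hyc'
  obtain ⟨t, ht, hinj⟩ := LinearMap.exists_ne_zero_injective_add_smul f g hf
  have hle : LinearMap.range (f + t • g) ≤ LinearMap.range (A + t • B) := by
    rintro _ ⟨⟨y, c⟩, rfl⟩
    refine ⟨s y + (t⁻¹ * c) • v, ?_⟩
    simp [f, g, hAs, hv, smul_smul, ht]
    abel
  have hdim := (Submodule.finrank_mono hle).trans (hrank t)
  rw [LinearMap.finrank_range_of_inj hinj, Module.finrank_prod, Module.finrank_self] at hdim
  omega

/-- **Flanders' Lemma.** Let `F` be an infinite field of characteristic different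
from 2, `n ≥ 1`, and let `M` be a linear subspace of the space of symmetric
`n × n` matrices over `F` all of whose members are singular. Then there is a
nonzero vector `v` with `vᵀ A v = 0` for all `A ∈ M`. -/
theorem flanders_singular_symmetric_subspace
    {F : Type*} [Field F] [Infinite F] (hchar : ringChar F ≠ 2)
    {n : ℕ} (hn : 1 ≤ n)
    (M : Submodule F (Matrix (Fin n) (Fin n) F))
    (hsymm : ∀ A ∈ M, A.IsSymm)
    (hsing : ∀ A ∈ M, A.det = 0) :
    ∃ v : Fin n → F, v ≠ 0 ∧ ∀ A ∈ M, v ⬝ᵥ A.mulVec v = 0 := by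
  obtain ⟨A, hAM, hmax⟩ : ∃ A ∈ M, ∀ B ∈ M, B.rank ≤ A.rank := by
    have hfin : (Matrix.rank '' (M : Set (Matrix (Fin n) (Fin n) F))).Finite :=
      (Set.finite_Iic n).subset (by
        rintro _ ⟨B, -, rfl⟩
        simpa using B.rank_le_width)
    obtain ⟨_, ⟨A, hA, rfl⟩, hmax⟩ :=
      Set.exists_max_image _ id hfin ⟨_, 0, M.zero_mem, rfl⟩
    exact ⟨A, hA, fun B hB => hmax _ ⟨B, hB, rfl⟩⟩
  obtain ⟨v, hv_ne, hv⟩ := Matrix.exists_mulVec_eq_zero_iff.mpr (hsing A hAM)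
  refine ⟨v, hv_ne, fun B hB => ?_⟩
  obtain ⟨w, hw⟩ := LinearMap.mem_range_of_forall_finrank_range_add_smul_le
    A.mulVecLin B.mulVecLin (fun t => by
      have hlin : A.mulVecLin + t • B.mulVecLin = (A + t • B).mulVecLin := by
        ext; simp
      rw [hlin]
      exact hmax _ (M.add_mem hAM (M.smul_mem t hB))) (v := v) hv
  rw [Matrix.mulVecLin_apply, Matrix.mulVecLin_apply] at hw
  rw [← hw, Matrix.dotProduct_mulVec, ← Matrix.mulVec_transpose, hsymm A hAM, hv,
    zero_dotProduct]
end

section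
/- Let F be an infinite field, let n ≥ 1 and 0 ≤ r ≤ n, and let M be a linear subspace of the space of n × n matrices over F such that every matrix in M has rank at most r. Suppose M contains a diagonal matrix A whose first r diagonal entries are nonzero and whose remaining diagonal entries are zero. Then every matrix B ∈ M satisfies B_{ij} = 0 for all indices i > r and j > r. -/
open Matrix

/-- Over an infinite field, the determinant of a matrix pencil that vanishes away from `t = 0`
also vanishes at `t = 0`. -/
theorem det_eq_zero_of_forall_det_add_smul_eq_zero {F m : Type*} [Field F] [Infinite F]
    [Fintype m] [DecidableEq m] (N P : Matrix m m F)
    (h : ∀ t : F, t ≠ 0 → (N + t • P).det = 0) : N.det = 0 := by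
  let p : Polynomial F := (N.map Polynomial.C + (Polynomial.X : Polynomial F) •
    P.map Polynomial.C).det
  have hp : ∀ t : F, p.eval t = (N + t • P).det := by
    intro t
    rw [← Polynomial.coe_evalRingHom, RingHom.map_det]
    congr 1
    ext i j
    simp [mul_comm t]
  have hzero : p = 0 := by
    refine Polynomial.eq_zero_of_infinite_isRoot p
      ((Set.finite_singleton (0 : F)).infinite_compl.mono fun t ht => ?_)
    exact (hp t).trans (h t ht)
  simpa [hzero] using (hp 0).symm

/-- If `D` is invertible and every nonzero `t` makes the block matrix obtained by perturbing
`D` by `t` times a given block matrix singular, then the lower right block is singular. -/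
theorem det_eq_zero_of_forall_det_fromBlocks_smul_eq_zero {F k l : Type*} [Field F] [Infinite F]
    [Fintype k] [DecidableEq k] [Fintype l] [DecidableEq l] (D B₁₁ : Matrix k k F)
    (B₁₂ : Matrix k l F) (B₂₁ : Matrix l k F) (B₂₂ : Matrix l l F) (hD : D.det ≠ 0)
    (h : ∀ t : F, t ≠ 0 →
      (fromBlocks (D + t • B₁₁) (t • B₁₂) (t • B₂₁) (t • B₂₂)).det = 0) :
    B₂₂.det = 0 := by
  have key : (fromBlocks D 0 B₂₁ B₂₂).det = 0 := by
    refine det_eq_zero_of_forall_det_add_smul_eq_zero _ (fromBlocks B₁₁ B₁₂ 0 0) fun t ht => ?_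
    have hfactor : fromBlocks (D + t • B₁₁) (t • B₁₂) (t • B₂₁) (t • B₂₂) =
        fromBlocks 1 0 0 (t • (1 : Matrix l l F)) *
          (fromBlocks D 0 B₂₁ B₂₂ + t • fromBlocks B₁₁ B₁₂ 0 0) := by
      simp [fromBlocks_multiply, fromBlocks_smul, fromBlocks_add]
    have hdet := h t ht
    rw [hfactor, det_mul, det_fromBlocks_zero₂₁, det_one, one_mul, det_smul, det_one,
      mul_one] at hdet
    exact (mul_eq_zero.mp hdet).resolve_left (pow_ne_zero _ ht)
  rw [det_fromBlocks_zero₁₂] at key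
  exact (mul_eq_zero.mp key).resolve_left hD

/-- A square submatrix larger than the rank is singular. -/
theorem det_submatrix_eq_zero_of_rank_lt {F m n k : Type*} [Field F] [Fintype n] [Fintype k]
    [DecidableEq k] (A : Matrix m n F) (e : k → m) (f : k → n) (h : A.rank < Fintype.card k) :
    (A.submatrix e f).det = 0 := by
  by_contra hdet
  have hfull := rank_of_isUnit (A.submatrix e f)
    ((isUnit_iff_isUnit_det _).mpr (isUnit_iff_ne_zero.mpr hdet))
  have hle := rank_submatrix_le A e f
  omega

/-- Let `F` be an infinite field, `1 ≤ n`, `r ≤ n`, and `M` a linear subspace of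
`n × n` matrices over `F` all of whose members have rank at most `r`. If `M`
contains a diagonal matrix `A` whose first `r` diagonal entries are nonzero and
whose remaining diagonal entries are zero, then every `B ∈ M` satisfies
`B i j = 0` whenever both indices lie beyond the first `r`. -/
theorem subspace_bounded_rank_corner_zero
    {F : Type*} [Field F] [Infinite F] {n r : ℕ} (hn : 1 ≤ n) (hr : r ≤ n)
    (M : Submodule F (Matrix (Fin n) (Fin n) F))
    (hrank : ∀ B ∈ M, B.rank ≤ r)
    (A : Matrix (Fin n) (Fin n) F) (hA : A ∈ M) (hdiag : A.IsDiag)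
    (hA1 : ∀ i : Fin n, (i : ℕ) < r → A i i ≠ 0)
    (hA2 : ∀ i : Fin n, r ≤ (i : ℕ) → A i i = 0) :
    ∀ B ∈ M, ∀ i j : Fin n, r ≤ (i : ℕ) → r ≤ (j : ℕ) → B i j = 0 := by
  intro B hB i j hi hj
  let e (i : Fin n) : Fin r ⊕ Unit → Fin n := Sum.elim (Fin.castLE hr) fun _ => i
  have hne : ∀ {k l : Fin n}, (k : ℕ) ≠ l → A k l = 0 := fun hkl =>
    hdiag fun h => hkl (congrArg Fin.val h)
  have hlow : ∀ k l : Fin n, r ≤ (k : ℕ) → A k l = 0 := fun k l hk => by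
    by_cases hkl : k = l
    · exact hkl ▸ hA2 k hk
    · exact hdiag hkl
  have hdet := det_eq_zero_of_forall_det_fromBlocks_smul_eq_zero
    (diagonal fun k : Fin r => A (Fin.castLE hr k) (Fin.castLE hr k))
    (B.submatrix (Fin.castLE hr) (Fin.castLE hr))
    (B.submatrix (Fin.castLE hr) fun _ : Unit => j)
    (B.submatrix (fun _ : Unit => i) (Fin.castLE hr))
    (B.submatrix (fun _ : Unit => i) fun _ : Unit => j)
    (by
      rw [det_diagonal]
      exact Finset.prod_ne_zero_iff.mpr fun k _ => hA1 _ k.isLt)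
    (fun t _ => by
      have hsing := det_submatrix_eq_zero_of_rank_lt (A + t • B) (e i) (e j) (by
        simpa using Nat.lt_succ_of_le (hrank _ (M.add_mem hA (M.smul_mem t hB))))
      convert hsing using 2
      ext (k | k) (l | l)
      · by_cases hkl : k = l
        · simp [e, hkl]
        · simp [e, hkl, hne (k := Fin.castLE hr k) (l := Fin.castLE hr l)
            (fun h => hkl (Fin.ext h))]
      · have hkj : (Fin.castLE hr k : ℕ) ≠ j := (k.isLt.trans_le hj).ne
        simp [e, hne hkj]
      · simp [e, hlow i _ hi]
      · simp [e, hlow i _ hi])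
  simpa using hdet
end

section
/- For a, b ∈ [0,∞] (the extended nonnegative reals) and n ∈ ℕ define S_n(a,b) := 2^{-n} · Σ_{j≥1} Σ_{k≥1} min( (min(a, j·2^{-n}) − min(a, (j−1)·2^{-n})), (min(b, k·2^{-n}) − min(b, (k−1)·2^{-n})) ), where the double sum is taken in [0,∞] and subtraction is truncated subtraction. Then for every a, b ∈ [0,∞] and every n ∈ ℕ one has S_n(a,b) ≤ a·b + 4^{-n} and a·b ≤ S_n(a,b) + 4^{-n}; in particular S_n converges to the product a·b uniformly in (a,b). -/
open ENNReal Filter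

/-- The `n`-th approximant to the product `a * b` in `[0,∞]`:
`Sₙ(a,b) = 2⁻ⁿ ∑_{j,k ≥ 1} min([min(a, j2⁻ⁿ) - min(a, (j-1)2⁻ⁿ)], [min(b, k2⁻ⁿ) - min(b, (k-1)2⁻ⁿ)])`,
with truncated subtraction, the sum taken in `[0,∞]`. -/
noncomputable def prodApprox (n : ℕ) (a b : ℝ≥0∞) : ℝ≥0∞ :=
  (2 : ℝ≥0∞)⁻¹ ^ n *
    ∑' j : ℕ+, ∑' k : ℕ+,
      min
        (min a (((j : ℕ) : ℝ≥0∞) * (2 : ℝ≥0∞)⁻¹ ^ n)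
          - min a ((((j : ℕ) - 1 : ℕ) : ℝ≥0∞) * (2 : ℝ≥0∞)⁻¹ ^ n))
        (min b (((k : ℕ) : ℝ≥0∞) * (2 : ℝ≥0∞)⁻¹ ^ n)
          - min b ((((k : ℕ) - 1 : ℕ) : ℝ≥0∞) * (2 : ℝ≥0∞)⁻¹ ^ n))

/-- The length of the part of `[0, a]` lying in the `i`-th cell `[iδ, (i+1)δ]` of mesh `δ`. -/
noncomputable def cellLength (δ a : ℝ≥0∞) (i : ℕ) : ℝ≥0∞ :=
  min a (((i + 1 : ℕ) : ℝ≥0∞) * δ) - min a ((i : ℝ≥0∞) * δ)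

open Classical in
/-- The indicator that `a` lies in the interior of the `i`-th cell of mesh `δ`. -/
noncomputable def cellIndicator (δ a : ℝ≥0∞) (i : ℕ) : ℝ≥0∞ :=
  if (i : ℝ≥0∞) * δ < a ∧ a < ((i + 1 : ℕ) : ℝ≥0∞) * δ then 1 else 0

theorem natCast_succ_mul_sub (δ : ℝ≥0∞) (hδ : δ ≠ ∞) (i : ℕ) :
    ((i + 1 : ℕ) : ℝ≥0∞) * δ - (i : ℝ≥0∞) * δ = δ := by
  rw [Nat.cast_succ, add_mul, one_mul]
  exact ENNReal.add_sub_cancel_left (ENNReal.mul_ne_top (ENNReal.natCast_ne_top i) hδ)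

theorem cellLength_le (δ a : ℝ≥0∞) (i : ℕ) : cellLength δ a i ≤ δ := by
  rw [cellLength, tsub_le_iff_right, Nat.cast_succ, add_mul, one_mul]
  rcases le_total a ((i : ℝ≥0∞) * δ) with h | h
  · rw [min_eq_left h]
    exact (min_le_left _ _).trans le_add_self
  · rw [min_eq_right h, add_comm δ]
    exact min_le_right _ _

theorem cellLength_eq_zero_or_eq_or_cellIndicator_eq_one {δ : ℝ≥0∞} (hδ : δ ≠ ∞) (a : ℝ≥0∞)
    (i : ℕ) : cellLength δ a i = 0 ∨ cellLength δ a i = δ ∨ cellIndicator δ a i = 1 := by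
  by_cases h₁ : (i : ℝ≥0∞) * δ < a
  · by_cases h₂ : a < ((i + 1 : ℕ) : ℝ≥0∞) * δ
    · exact Or.inr (Or.inr (if_pos ⟨h₁, h₂⟩))
    · refine Or.inr (Or.inl ?_)
      rw [cellLength, min_eq_right (not_lt.1 h₂), min_eq_right h₁.le, natCast_succ_mul_sub δ hδ]
  · refine Or.inl ?_
    rw [cellLength, min_eq_left (not_lt.1 h₁)]
    exact tsub_eq_zero_of_le (min_le_left _ _)

theorem sum_range_cellLength (δ a : ℝ≥0∞) (N : ℕ) :
    ∑ i ∈ Finset.range N, cellLength δ a i = min a ((N : ℝ≥0∞) * δ) := by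
  induction N with
  | zero => simp
  | succ N ih =>
    rw [Finset.sum_range_succ, ih, cellLength]
    refine add_tsub_cancel_of_le (min_le_min_left a ?_)
    gcongr
    exact N.le_succ

theorem tsum_cellLength {δ : ℝ≥0∞} (hδ : δ ≠ 0) (a : ℝ≥0∞) : ∑' i, cellLength δ a i = a := by
  simp only [ENNReal.tsum_eq_iSup_nat, sum_range_cellLength]
  rw [← inf_iSup_eq, ← ENNReal.iSup_mul, ENNReal.iSup_natCast, ENNReal.top_mul hδ, inf_top_eq]

theorem tsum_cellIndicator_le_one (δ a : ℝ≥0∞) : ∑' i, cellIndicator δ a i ≤ 1 := by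
  by_cases h : ∃ i : ℕ, (i : ℝ≥0∞) * δ < a ∧ a < ((i + 1 : ℕ) : ℝ≥0∞) * δ
  · obtain ⟨i, hi⟩ := h
    have not_lt_of_cells {j k : ℕ} (hj : a < ((j + 1 : ℕ) : ℝ≥0∞) * δ)
        (hk : (k : ℝ≥0∞) * δ < a) : ¬ j < k := by
      intro hjk
      have : ((j + 1 : ℕ) : ℝ≥0∞) * δ ≤ (k : ℝ≥0∞) * δ := by
        gcongr
        exact hjk
      exact absurd (hj.trans_le this) hk.not_gt
    rw [tsum_eq_single i]
    · exact (if_pos hi).le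
    · intro j hji
      refine if_neg fun hj => hji ?_
      exact le_antisymm (not_lt.1 (not_lt_of_cells hi.2 hj.1))
        (not_lt.1 (not_lt_of_cells hj.2 hi.1))
  · have (i : ℕ) : cellIndicator δ a i = 0 := if_neg fun hi => h ⟨i, hi⟩
    simp [this]

theorem mul_min_cellLength_le {δ : ℝ≥0∞} (hδ : δ ≠ ∞) (a b : ℝ≥0∞) (i j : ℕ) :
    δ * min (cellLength δ a i) (cellLength δ b j) ≤
      cellLength δ a i * cellLength δ b j
        + δ * δ * (cellIndicator δ a i * cellIndicator δ b j) := by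
  rcases cellLength_eq_zero_or_eq_or_cellIndicator_eq_one hδ a i with ha | ha | ha
  · simp [ha]
  · rw [ha]
    refine le_add_right ?_
    gcongr
    exact min_le_right _ _
  rcases cellLength_eq_zero_or_eq_or_cellIndicator_eq_one hδ b j with hb | hb | hb
  · simp [hb]
  · rw [hb, mul_comm δ]
    refine le_add_right ?_
    gcongr
    exact min_le_left _ _
  · rw [ha, hb, mul_one, mul_one]
    refine le_add_left ?_
    gcongr
    exact (min_le_left _ _).trans (cellLength_le δ a i)

theorem mul_cellLength_le (δ a b : ℝ≥0∞) (i j : ℕ) :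
    cellLength δ a i * cellLength δ b j ≤
      δ * min (cellLength δ a i) (cellLength δ b j) := by
  rcases le_total (cellLength δ a i) (cellLength δ b j) with h | h
  · rw [min_eq_left h, mul_comm]
    gcongr
    exact cellLength_le δ b j
  · rw [min_eq_right h]
    gcongr
    exact cellLength_le δ a i

theorem tsum_tsum_mul (f g : ℕ → ℝ≥0∞) :
    ∑' i, ∑' j, f i * g j = (∑' i, f i) * ∑' j, g j := by
  simp_rw [ENNReal.tsum_mul_left, ENNReal.tsum_mul_right]

theorem prodApprox_eq_tsum (n : ℕ) (a b : ℝ≥0∞) :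
    prodApprox n a b = ∑' i, ∑' j, (2 : ℝ≥0∞)⁻¹ ^ n *
      min (cellLength ((2 : ℝ≥0∞)⁻¹ ^ n) a i) (cellLength ((2 : ℝ≥0∞)⁻¹ ^ n) b j) := by
  simp_rw [ENNReal.tsum_mul_left]
  rw [prodApprox, tsum_pnat_eq_tsum_succ (f := fun j : ℕ => ∑' k : ℕ+,
      min (min a ((j : ℝ≥0∞) * (2 : ℝ≥0∞)⁻¹ ^ n)
          - min a (((j - 1 : ℕ) : ℝ≥0∞) * (2 : ℝ≥0∞)⁻¹ ^ n))
        (min b (((k : ℕ) : ℝ≥0∞) * (2 : ℝ≥0∞)⁻¹ ^ n)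
          - min b ((((k : ℕ) - 1 : ℕ) : ℝ≥0∞) * (2 : ℝ≥0∞)⁻¹ ^ n)))]
  congr 1
  refine tsum_congr fun i => ?_
  exact tsum_pnat_eq_tsum_succ (f := fun k : ℕ =>
      min (cellLength ((2 : ℝ≥0∞)⁻¹ ^ n) a i)
        (min b ((k : ℝ≥0∞) * (2 : ℝ≥0∞)⁻¹ ^ n)
          - min b (((k - 1 : ℕ) : ℝ≥0∞) * (2 : ℝ≥0∞)⁻¹ ^ n)))

theorem mul_le_prodApprox (n : ℕ) (a b : ℝ≥0∞) : a * b ≤ prodApprox n a b := by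
  have hδ : (2 : ℝ≥0∞)⁻¹ ^ n ≠ 0 := by simp
  rw [prodApprox_eq_tsum]
  conv_lhs => rw [← tsum_cellLength hδ a, ← tsum_cellLength hδ b, ← tsum_tsum_mul]
  exact ENNReal.tsum_le_tsum fun i => ENNReal.tsum_le_tsum fun j => mul_cellLength_le _ a b i j

theorem prodApprox_le_mul_add (n : ℕ) (a b : ℝ≥0∞) :
    prodApprox n a b ≤ a * b + (4 : ℝ≥0∞)⁻¹ ^ n := by
  have hδ : (2 : ℝ≥0∞)⁻¹ ^ n ≠ 0 := by simp
  have hδ' : (2 : ℝ≥0∞)⁻¹ ^ n ≠ ∞ := by simp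
  have h4 : (4 : ℝ≥0∞)⁻¹ ^ n = (2 : ℝ≥0∞)⁻¹ ^ n * (2 : ℝ≥0∞)⁻¹ ^ n := by
    rw [← mul_pow, ← ENNReal.mul_inv (by simp) (by simp)]
    norm_num
  rw [prodApprox_eq_tsum, h4]
  generalize (2 : ℝ≥0∞)⁻¹ ^ n = δ at *
  calc ∑' i, ∑' j, δ * min (cellLength δ a i) (cellLength δ b j)
      ≤ ∑' i, ∑' j, (cellLength δ a i * cellLength δ b j
          + δ * δ * (cellIndicator δ a i * cellIndicator δ b j)) :=
        ENNReal.tsum_le_tsum fun i => ENNReal.tsum_le_tsum fun j =>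
          mul_min_cellLength_le hδ' a b i j
    _ = a * b + δ * δ * ((∑' i, cellIndicator δ a i) * ∑' j, cellIndicator δ b j) := by
        simp_rw [ENNReal.tsum_add, ENNReal.tsum_mul_left, ENNReal.tsum_mul_right,
          tsum_cellLength hδ]
    _ ≤ a * b + δ * δ * (1 * 1) := by
        gcongr <;> exact tsum_cellIndicator_le_one _ _
    _ = a * b + δ * δ := by rw [mul_one, mul_one]

/-- For all `a, b ∈ [0,∞]` and all `n`, `Sₙ(a,b) ≤ a·b + 4⁻ⁿ` and
`a·b ≤ Sₙ(a,b) + 4⁻ⁿ`; in particular `Sₙ` converges to the product uniformly in `(a,b)`. -/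
theorem prodApprox_le_add_and_ge_sub :
    (∀ (a b : ℝ≥0∞) (n : ℕ),
        prodApprox n a b ≤ a * b + (4 : ℝ≥0∞)⁻¹ ^ n ∧
        a * b ≤ prodApprox n a b + (4 : ℝ≥0∞)⁻¹ ^ n) ∧
    (∀ ε : ℝ≥0∞, 0 < ε → ∃ N : ℕ, ∀ n ≥ N, ∀ a b : ℝ≥0∞,
        prodApprox n a b ≤ a * b + ε ∧ a * b ≤ prodApprox n a b + ε) := by
  refine ⟨fun a b n => ⟨prodApprox_le_mul_add n a b, le_add_right (mul_le_prodApprox n a b)⟩,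
    fun ε hε => ?_⟩
  have hlim : Tendsto (fun n : ℕ => (4 : ℝ≥0∞)⁻¹ ^ n) atTop (nhds 0) :=
    ENNReal.tendsto_pow_atTop_nhds_zero_of_lt_one (ENNReal.inv_lt_one.2 (by norm_num))
  obtain ⟨N, hN⟩ := eventually_atTop.1 (hlim.eventually_le_const hε)
  refine ⟨N, fun n hn a b => ⟨?_, le_add_right (mul_le_prodApprox n a b)⟩⟩
  exact (prodApprox_le_mul_add n a b).trans (by gcongr; exact hN n hn)
end

section
/- Let X be a second-countable locally compact Hausdorff topological space equipped with its Borel σ-algebra, and let (νₙ)_{n∈ℕ} be a sequence of Borel measures on X, each finite on every compact set. Then there exists a sequence (αₙ)_{n∈ℕ} of positive real numbers such that the measure ν := Σₙ αₙ·νₙ is finite on every compact set, and moreover νₙ ≤ αₙ⁻¹·ν for every n; in particular each νₙ is absolutely continuous with respect to ν. -/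
open MeasureTheory NNReal ENNReal

/-- If `(νₙ)` is a sequence of Borel measures on a second-countable locally compact
Hausdorff space `X`, each finite on compact sets, then there are positive reals `αₙ`
such that `ν := Σₙ αₙ νₙ` is finite on compact sets, `νₙ ≤ αₙ⁻¹ ν` for each `n`,
and in particular each `νₙ` is absolutely continuous w.r.t. `ν`. -/
theorem exists_pos_coeffs_sum_radon
    {X : Type*} [TopologicalSpace X] [SecondCountableTopology X]
    [LocallyCompactSpace X] [T2Space X] [MeasurableSpace X] [BorelSpace X]
    (ν : ℕ → Measure X)
    (hν : ∀ n, ∀ K : Set X, IsCompact K → ν n K < ⊤) :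
    ∃ α : ℕ → ℝ≥0, (∀ n, 0 < α n) ∧
      (∀ K : Set X, IsCompact K → Measure.sum (fun n => α n • ν n) K < ⊤) ∧
      (∀ n, ν n ≤ (α n)⁻¹ • Measure.sum (fun n => α n • ν n)) ∧
      (∀ n, ν n ≪ Measure.sum (fun n => α n • ν n)) := by
  obtain ⟨E⟩ : Nonempty (CompactExhaustion X) := inferInstance
  obtain ⟨α, hα, hsum⟩ := ENNReal.exists_pos_tsum_mul_lt_of_countable one_ne_zero
    (fun n => ν n (E n)) (fun n => (hν n _ (E.isCompact n)).ne)
  have hle : ∀ n, ν n ≤ (α n)⁻¹ • Measure.sum (fun n => α n • ν n) := fun n => by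
    calc ν n = (α n)⁻¹ • (α n • ν n) := by
          rw [smul_smul, inv_mul_cancel₀ (hα n).ne', one_smul]
      _ ≤ (α n)⁻¹ • Measure.sum (fun n => α n • ν n) := by
          gcongr
          exact Measure.le_sum (fun n => α n • ν n) n
  refine ⟨α, hα, fun K hK => ?_, hle, fun n =>
    (Measure.absolutelyContinuous_of_le (hle n)).trans Measure.smul_absolutelyContinuous⟩
  obtain ⟨m, hm⟩ := E.exists_superset_of_isCompact hK
  have hsplit := Summable.sum_add_tsum_nat_add' (f := fun n => ν n K * (α n : ℝ≥0∞))
    (k := m) ENNReal.summable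
  have hhead : ∑ n ∈ Finset.range m, ν n K * (α n : ℝ≥0∞) < ⊤ :=
    ENNReal.sum_lt_top.2 fun n _ => ENNReal.mul_lt_top (hν n K hK) ENNReal.coe_lt_top
  have htail : ∑' n, ν (n + m) K * (α (n + m) : ℝ≥0∞) < ⊤ := by
    calc ∑' n, ν (n + m) K * (α (n + m) : ℝ≥0∞)
        ≤ ∑' n, ν (n + m) (E (n + m)) * α (n + m) := by
          refine ENNReal.tsum_le_tsum fun n => ?_
          gcongr
          exact hm.trans (E.subset (Nat.le_add_left m n))
      _ ≤ ∑' n, ν n (E n) * α n :=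
          ENNReal.tsum_comp_le_tsum_of_injective (add_left_injective m)
            (fun n => ν n (E n) * (α n : ℝ≥0∞))
      _ < ⊤ := hsum.trans ENNReal.one_lt_top
  have hsum_apply : Measure.sum (fun n => α n • ν n) K = ∑' n, ν n K * (α n : ℝ≥0∞) := by
    rw [Measure.sum_apply _ hK.measurableSet]
    refine tsum_congr fun n => ?_
    rw [Measure.smul_apply, ENNReal.smul_def, smul_eq_mul, mul_comm]
  rw [hsum_apply, ← hsplit]
  exact ENNReal.add_lt_top.2 ⟨hhead, htail⟩
end

section
/- Let X be a second-countable locally compact Hausdorff space, and let μ and ν be Borel measures on X that are finite on every compact set. Then for every test function h on X, ∫⁻ h d(μ ⊓ ν) = ⨅ { ∫⁻ h₁ dμ + ∫⁻ h₂ dν : h₁, h₂ test functions on X with h ≤ h₁ + h₂ }, where μ ⊓ ν denotes the infimum of μ and ν in the lattice of Borel measures on X and ∫⁻ denotes the Lebesgue (lower) integral with values in [0,∞]. -/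
open MeasureTheory NNReal ENNReal

/-- A test function: a nonnegative continuous function with compact support. -/
def IsTestFun {X : Type*} [TopologicalSpace X] (h : X → ℝ≥0) : Prop :=
  Continuous h ∧ HasCompactSupport h

/-- Over a set of finite measure for both `μ` and `ν`, the infimum `μ ⊓ ν` dominates `μ` on a
suitable measurable part and `ν` on the rest. -/
lemma exists_measurableSet_restrict_add_restrict_compl_le_inf {X : Type*} [MeasurableSpace X]
    (μ ν : Measure X) {K : Set X} (hμ : μ K < ⊤) (hν : ν K < ⊤) :
    ∃ s, MeasurableSet s ∧
      (μ.restrict K).restrict s + (ν.restrict K).restrict sᶜ ≤ μ ⊓ ν := by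
  have : IsFiniteMeasure (μ.restrict K) := ⟨by simpa using hμ⟩
  have : IsFiniteMeasure (ν.restrict K) := ⟨by simpa using hν⟩
  obtain ⟨s, hs⟩ := exists_isHahnDecomposition (μ.restrict K) (ν.restrict K)
  refine ⟨s, hs.measurableSet, le_inf ?_ ?_⟩
  · calc (μ.restrict K).restrict s + (ν.restrict K).restrict sᶜ
        ≤ (μ.restrict K).restrict s + (μ.restrict K).restrict sᶜ :=
          add_le_add le_rfl hs.ge_on_compl
      _ = μ.restrict K := Measure.restrict_add_restrict_compl hs.measurableSet
      _ ≤ μ := Measure.restrict_le_self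
  · calc (μ.restrict K).restrict s + (ν.restrict K).restrict sᶜ
        ≤ (ν.restrict K).restrict s + (ν.restrict K).restrict sᶜ :=
          add_le_add hs.le_on le_rfl
      _ = ν.restrict K := Measure.restrict_add_restrict_compl hs.measurableSet
      _ ≤ ν := Measure.restrict_le_self

/-- In a normal space, an open cover by two sets has a continuous partition of unity. -/
lemma exists_continuous_add_eq_one_of_union_eq_univ {X : Type*} [TopologicalSpace X]
    [NormalSpace X] {U V : Set X} (hU : IsOpen U) (hV : IsOpen V) (hUV : U ∪ V = Set.univ) :
    ∃ φ ψ : X → ℝ≥0, Continuous φ ∧ Continuous ψ ∧ (∀ x, φ x + ψ x = 1) ∧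
      (∀ x ∉ U, φ x = 0) ∧ ∀ x ∉ V, ψ x = 0 := by
  obtain ⟨f, hf0, hf1, hf⟩ := exists_continuous_zero_one_of_isClosed
    hU.isClosed_compl hV.isClosed_compl (by
      rw [Set.disjoint_compl_left_iff_subset, Set.compl_subset_iff_union, Set.union_comm, hUV])
  have hle (x : X) : (f x).toNNReal ≤ 1 := Real.toNNReal_le_one.2 (hf x).2
  refine ⟨fun x ↦ (f x).toNNReal, fun x ↦ 1 - (f x).toNNReal, by fun_prop, by fun_prop,
    fun x ↦ add_tsub_cancel_of_le (hle x), fun x hx ↦ ?_, fun x hx ↦ ?_⟩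
  · simp [hf0 hx]
  · simp [hf1 hx]

lemma IsTestFun.mul_right {X : Type*} [TopologicalSpace X] {h φ : X → ℝ≥0}
    (hh : IsTestFun h) (hφ : Continuous φ) : IsTestFun (fun x ↦ h x * φ x) :=
  ⟨hh.1.mul hφ, hh.2.mul_right⟩

lemma setLIntegral_tsupport {X : Type*} [TopologicalSpace X] [MeasurableSpace X] (μ : Measure X)
    (h : X → ℝ≥0) : ∫⁻ x in tsupport h, h x ∂μ = ∫⁻ x, h x ∂μ :=
  setLIntegral_eq_of_support_subset fun x hx ↦ subset_tsupport h (by simpa using hx)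

lemma IsTestFun.lintegral_lt_top {X : Type*} [TopologicalSpace X] [MeasurableSpace X]
    [OpensMeasurableSpace X] {μ : Measure X} (hμ : ∀ K : Set X, IsCompact K → μ K < ⊤)
    {h : X → ℝ≥0} (hh : IsTestFun h) : ∫⁻ x, h x ∂μ < ⊤ := by
  rw [← setLIntegral_tsupport]
  exact setLIntegral_lt_top_of_isCompact (hμ _ hh.2).ne hh.2 hh.1

/-- If `φ ≤ 1` vanishes off `U`, then the integral of `h * φ` is at most that of `h` over `U`. -/
lemma lintegral_mul_le_setLIntegral {X : Type*} [MeasurableSpace X] (μ : Measure X)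
    {h φ : X → ℝ≥0} {U : Set X} (hU : MeasurableSet U) (hφ : ∀ x, φ x ≤ 1)
    (hφU : ∀ x ∉ U, φ x = 0) :
    ∫⁻ x, (h x * φ x : ℝ≥0) ∂μ ≤ ∫⁻ x in U, h x ∂μ := by
  rw [← lintegral_indicator hU]
  refine lintegral_mono fun x ↦ ?_
  by_cases hx : x ∈ U
  · simpa [hx] using mul_le_of_le_one_right' (ENNReal.coe_le_one_iff.2 (hφ x))
  · simp [hx, hφU x hx]

/-- For Borel measures `μ, ν` finite on compacta on a second-countable locally compact
Hausdorff space, and any test function `h`,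
`∫⁻ h d(μ ⊓ ν) = ⨅ {∫⁻ h₁ dμ + ∫⁻ h₂ dν : h₁, h₂ test functions, h ≤ h₁ + h₂}`. -/
theorem lintegral_inf_eq_iInf_testFun
    {X : Type*} [TopologicalSpace X] [SecondCountableTopology X]
    [LocallyCompactSpace X] [T2Space X] [MeasurableSpace X] [BorelSpace X]
    (μ ν : Measure X)
    (hμ : ∀ K : Set X, IsCompact K → μ K < ⊤)
    (hν : ∀ K : Set X, IsCompact K → ν K < ⊤)
    (h : X → ℝ≥0) (hh : IsTestFun h) :
    ∫⁻ x, (h x : ℝ≥0∞) ∂(μ ⊓ ν) =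
      ⨅ p : {q : (X → ℝ≥0) × (X → ℝ≥0) //
          IsTestFun q.1 ∧ IsTestFun q.2 ∧ ∀ x, h x ≤ q.1 x + q.2 x},
        (∫⁻ x, ((p : (X → ℝ≥0) × (X → ℝ≥0)).1 x : ℝ≥0∞) ∂μ) +
          ∫⁻ x, ((p : (X → ℝ≥0) × (X → ℝ≥0)).2 x : ℝ≥0∞) ∂ν := by
  apply le_antisymm
  · refine le_iInf fun ⟨⟨h₁, h₂⟩, hh₁, _, hle⟩ ↦ ?_
    calc ∫⁻ x, (h x : ℝ≥0∞) ∂(μ ⊓ ν)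
        ≤ ∫⁻ x, ((h₁ x : ℝ≥0∞) + h₂ x) ∂(μ ⊓ ν) :=
          lintegral_mono fun x ↦ ENNReal.coe_le_coe.2 (hle x)
      _ = ∫⁻ x, (h₁ x : ℝ≥0∞) ∂(μ ⊓ ν) + ∫⁻ x, (h₂ x : ℝ≥0∞) ∂(μ ⊓ ν) :=
          lintegral_add_left hh₁.1.measurable.coe_nnreal_ennreal _
      _ ≤ _ := add_le_add (lintegral_mono' inf_le_left le_rfl)
          (lintegral_mono' inf_le_right le_rfl)
  · have hKm : MeasurableSet (tsupport h) := (isClosed_tsupport h).measurableSet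
    obtain ⟨s, hs, hinf⟩ := exists_measurableSet_restrict_add_restrict_compl_le_inf μ ν
      (hμ _ hh.2) (hν _ hh.2)
    let μ' := μ.withDensity fun x ↦ (h x : ℝ≥0∞)
    let ν' := ν.withDensity fun x ↦ (h x : ℝ≥0∞)
    have : IsFiniteMeasure μ' := isFiniteMeasure_withDensity (hh.lintegral_lt_top hμ).ne
    have : IsFiniteMeasure ν' := isFiniteMeasure_withDensity (hh.lintegral_lt_top hν).ne
    have hsupp (ρ : Measure X) {t : Set X} (ht : MeasurableSet t) :
        ∫⁻ x in t, h x ∂(ρ.restrict (tsupport h)) = ρ.withDensity (fun x ↦ (h x : ℝ≥0∞)) t := by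
      rw [withDensity_apply _ ht, Measure.restrict_restrict ht, Set.inter_comm,
        ← Measure.restrict_restrict hKm]
      exact setLIntegral_tsupport _ h
    have hlower : μ' s + ν' sᶜ ≤ ∫⁻ x, (h x : ℝ≥0∞) ∂(μ ⊓ ν) := by
      rw [← hsupp μ hs, ← hsupp ν hs.compl, ← lintegral_add_measure]
      exact lintegral_mono' hinf le_rfl
    refine ENNReal.le_of_forall_pos_le_add fun ε hε _ ↦ ?_
    have hε2 : ((ε / 2 : ℝ≥0) : ℝ≥0∞) ≠ 0 := by simpa using hε.ne'
    obtain ⟨U, hsU, hU, hμU⟩ := s.exists_isOpen_le_add μ' hε2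
    obtain ⟨V, hsV, hV, hνV⟩ := sᶜ.exists_isOpen_le_add ν' hε2
    have hUV : U ∪ V = Set.univ :=
      Set.univ_subset_iff.1 (s.union_compl_self ▸ Set.union_subset_union hsU hsV)
    obtain ⟨φ, ψ, hφ, hψ, hφψ, hφU, hψV⟩ :=
      exists_continuous_add_eq_one_of_union_eq_univ hU hV hUV
    have hdecomp (x : X) : h x ≤ h x * φ x + h x * ψ x := by rw [← mul_add, hφψ, mul_one]
    refine (iInf_le _ ⟨(fun x ↦ h x * φ x, fun x ↦ h x * ψ x),
      hh.mul_right hφ, hh.mul_right hψ, hdecomp⟩).trans ?_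
    calc ∫⁻ x, (h x * φ x : ℝ≥0) ∂μ + ∫⁻ x, (h x * ψ x : ℝ≥0) ∂ν
        ≤ ∫⁻ x in U, h x ∂μ + ∫⁻ x in V, h x ∂ν := add_le_add
          (lintegral_mul_le_setLIntegral μ hU.measurableSet
            (fun x ↦ (hφψ x) ▸ le_self_add) hφU)
          (lintegral_mul_le_setLIntegral ν hV.measurableSet
            (fun x ↦ (hφψ x) ▸ le_add_self) hψV)
      _ = μ' U + ν' V := by
          rw [withDensity_apply _ hU.measurableSet, withDensity_apply _ hV.measurableSet]
      _ ≤ (μ' s + (ε / 2 : ℝ≥0)) + (ν' sᶜ + (ε / 2 : ℝ≥0)) := add_le_add hμU hνV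
      _ = μ' s + ν' sᶜ + ε := by
          rw [add_add_add_comm, ← ENNReal.coe_add, add_halves]
      _ ≤ _ := by gcongr
end

section
/- Let μ₁, μ₂, ν₁, ν₂ be σ-finite measures on a measurable space with μ₁ ≤ μ₂ and ν₁ ≤ ν₂. Then μ₂ ⊓ ν₁ + μ₁ ⊓ ν₂ ≤ μ₂ ⊓ ν₂ + μ₁ ⊓ ν₁, where ⊓ denotes the infimum in the lattice of measures and ≤ is the pointwise order on measures. -/
open MeasureTheory

namespace MeasureTheory.Measure

variable {α : Type*} [MeasurableSpace α]

lemma withDensity_inf (ρ : Measure α) {f g : α → ENNReal}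
    (hf : Measurable f) (hg : Measurable g) :
    ρ.withDensity (f ⊓ g) = ρ.withDensity f ⊓ ρ.withDensity g := by
  refine le_antisymm (le_inf (withDensity_mono (ae_of_all _ fun _ => inf_le_left))
    (withDensity_mono (ae_of_all _ fun _ => inf_le_right))) ?_
  refine Measure.le_iff.2 fun s hs => ?_
  have ht : MeasurableSet {x | f x ≤ g x} := measurableSet_le hf hg
  rw [← measure_inter_add_sdiff s ht, ← measure_inter_add_sdiff s ht]
  refine add_le_add ((inf_le_left (a := ρ.withDensity f) _).trans_eq ?_)
    ((inf_le_right (b := ρ.withDensity g) _).trans_eq ?_)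
  · rw [withDensity_apply _ (hs.inter ht), withDensity_apply _ (hs.inter ht)]
    exact setLIntegral_congr_fun (hs.inter ht) fun x hx => (inf_eq_left.2 hx.2).symm
  · rw [withDensity_apply _ (hs.diff ht), withDensity_apply _ (hs.diff ht)]
    exact setLIntegral_congr_fun (hs.diff ht) fun x hx =>
      (inf_eq_right.2 (not_le.1 hx.2).le).symm

lemma rnDeriv_ae_le_of_le {μ ν ρ : Measure α} [SigmaFinite μ] [SigmaFinite ν] [SigmaFinite ρ]
    (hμν : μ ≤ ν) (hν : ν ≪ ρ) : μ.rnDeriv ρ ≤ᵐ[ρ] ν.rnDeriv ρ := by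
  refine ae_le_of_forall_setLIntegral_le_of_sigmaFinite (measurable_rnDeriv μ ρ)
    fun s _ _ => ?_
  rw [setLIntegral_rnDeriv (hμν.absolutelyContinuous.trans hν), setLIntegral_rnDeriv hν]
  exact hμν s

end MeasureTheory.Measure

lemma min_add_min_le_min_add_min {β : Type*} [AddCommMonoid β] [LinearOrder β]
    [IsOrderedAddMonoid β] {a b c d : β} (hab : a ≤ b) (hcd : c ≤ d) :
    min b c + min a d ≤ min b d + min a c := by
  rcases le_total a c with hac | hca
  · rw [min_eq_left hac, min_eq_left (hac.trans hcd)]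
    gcongr
  · rw [min_eq_right hca, min_eq_right (hca.trans hab), add_comm]
    gcongr

/-- For σ-finite measures with `μ₁ ≤ μ₂` and `ν₁ ≤ ν₂`,
`μ₂ ⊓ ν₁ + μ₁ ⊓ ν₂ ≤ μ₂ ⊓ ν₂ + μ₁ ⊓ ν₁` (infima in the lattice of measures). -/
theorem inf_add_inf_le_inf_add_inf
    {α : Type*} [MeasurableSpace α] (μ₁ μ₂ ν₁ ν₂ : Measure α)
    [SigmaFinite μ₁] [SigmaFinite μ₂] [SigmaFinite ν₁] [SigmaFinite ν₂]
    (h₁ : μ₁ ≤ μ₂) (h₂ : ν₁ ≤ ν₂) :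
    μ₂ ⊓ ν₁ + μ₁ ⊓ ν₂ ≤ μ₂ ⊓ ν₂ + μ₁ ⊓ ν₁ := by
  obtain ⟨ρ, hρ, hμ, hν⟩ : ∃ ρ : Measure α, SigmaFinite ρ ∧ μ₂ ≪ ρ ∧ ν₂ ≪ ρ :=
    ⟨μ₂ + ν₂, inferInstance, Measure.AbsolutelyContinuous.rfl.add_right _,
      Measure.absolutelyContinuous_of_le (Measure.le_add_left le_rfl)⟩
  have hf := Measure.rnDeriv_ae_le_of_le h₁ hμ
  have hg := Measure.rnDeriv_ae_le_of_le h₂ hν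
  have m (μ : Measure α) : Measurable (μ.rnDeriv ρ) := Measure.measurable_rnDeriv μ ρ
  rw [← Measure.withDensity_rnDeriv_eq μ₁ ρ (h₁.absolutelyContinuous.trans hμ),
    ← Measure.withDensity_rnDeriv_eq ν₁ ρ (h₂.absolutelyContinuous.trans hν),
    ← Measure.withDensity_rnDeriv_eq μ₂ ρ hμ, ← Measure.withDensity_rnDeriv_eq ν₂ ρ hν]
  simp only [← Measure.withDensity_inf ρ (m _) (m _)]
  rw [← withDensity_add_left ((m _).inf (m _)), ← withDensity_add_left ((m _).inf (m _))]
  refine withDensity_mono ?_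
  filter_upwards [hf, hg] with x hfx hgx
  exact min_add_min_le_min_add_min hfx hgx
end

section
/- Let ρ be a σ-finite measure on a measurable space, let μ be a σ-finite measure with μ ≪ ρ, and let (νⱼ)_{j∈ℕ} be a pointwise nondecreasing sequence of σ-finite measures with νⱼ ≪ ρ for all j. Then ⨆ⱼ (μ ⊓ νⱼ) = μ ⊓ (⨆ⱼ νⱼ), where ⊓ and ⨆ denote the infimum and supremum in the lattice of measures. -/
open MeasureTheory

/-- Comparing densities: an inequality of measures passes to an almost everywhere inequality
between the Radon–Nikodym derivative of the smaller one and any density of the larger one. -/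
theorem MeasureTheory.Measure.rnDeriv_ae_le_of_le_withDensity
    {α : Type*} [MeasurableSpace α] {ρ κ : Measure α} [SigmaFinite ρ] [SigmaFinite κ]
    (hκ : κ ≪ ρ) {g : α → ENNReal} (h : κ ≤ ρ.withDensity g) :
    κ.rnDeriv ρ ≤ᵐ[ρ] g := by
  refine ae_le_of_forall_setLIntegral_le_of_sigmaFinite (Measure.measurable_rnDeriv _ _)
    fun s hs _ ↦ ?_
  rw [Measure.setLIntegral_rnDeriv hκ, ← withDensity_apply _ hs]
  exact h s

/-- For σ-finite measures all absolutely continuous w.r.t. a σ-finite `ρ`, with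
`(νⱼ)` pointwise nondecreasing, the lattice infimum with `μ` commutes with the
lattice supremum: `⨆ⱼ (μ ⊓ νⱼ) = μ ⊓ ⨆ⱼ νⱼ`. -/
theorem iSup_inf_eq_inf_iSup_of_monotone
    {α : Type*} [MeasurableSpace α] (ρ μ : Measure α) (ν : ℕ → Measure α)
    [SigmaFinite ρ] [SigmaFinite μ] [∀ j, SigmaFinite (ν j)]
    (hμ : μ ≪ ρ) (hν : ∀ j, ν j ≪ ρ) (hmono : Monotone ν) :
    ⨆ j, μ ⊓ ν j = μ ⊓ ⨆ j, ν j := by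
  refine le_antisymm (iSup_inf_le_inf_iSup _ _) ?_
  set κ := μ ⊓ ⨆ j, ν j
  have hκμ : κ ≤ μ := inf_le_left
  have hκρ : κ ≪ ρ := (Measure.absolutelyContinuous_of_le hκμ).trans hμ
  have : SigmaFinite κ := Measure.sigmaFinite_of_le μ hκμ
  have hmeas (j : ℕ) : Measurable ((ν j).rnDeriv ρ) := Measure.measurable_rnDeriv _ _
  have hdens (j : ℕ) : ρ.withDensity ((ν j).rnDeriv ρ) = ν j :=
    Measure.withDensity_rnDeriv_eq _ _ (hν j)
  have hκsup : κ ≤ ρ.withDensity (fun x ↦ ⨆ j, (ν j).rnDeriv ρ x) := by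
    refine inf_le_right.trans (iSup_le fun j ↦ ?_)
    rw [← hdens j]
    exact withDensity_mono (.of_forall fun x ↦ le_iSup (fun i ↦ (ν i).rnDeriv ρ x) j)
  have hle := Measure.rnDeriv_ae_le_of_le_withDensity hκρ hκsup
  have hmono_ae : ∀ᵐ x ∂ρ, Monotone fun j ↦ κ.rnDeriv ρ x ⊓ (ν j).rnDeriv ρ x := by
    have hstep : ∀ᵐ x ∂ρ, ∀ j, (ν j).rnDeriv ρ x ≤ (ν (j + 1)).rnDeriv ρ x :=
      ae_all_iff.2 fun j ↦ Measure.rnDeriv_ae_le_of_le_withDensity (hν j) <| by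
        rw [hdens]
        exact hmono j.le_succ
    filter_upwards [hstep] with x hx
    exact monotone_const.inf (monotone_nat_of_le_succ hx)
  refine Measure.le_iff.2 fun s hs ↦ ?_
  calc κ s = ∫⁻ x in s, κ.rnDeriv ρ x ∂ρ := (Measure.setLIntegral_rnDeriv hκρ s).symm
    _ = ∫⁻ x in s, ⨆ j, κ.rnDeriv ρ x ⊓ (ν j).rnDeriv ρ x ∂ρ := by
      refine lintegral_congr_ae (ae_restrict_of_ae ?_)
      filter_upwards [hle] with x hx
      rw [← inf_iSup_eq, inf_eq_left.2 hx]
    _ = ⨆ j, ∫⁻ x in s, κ.rnDeriv ρ x ⊓ (ν j).rnDeriv ρ x ∂ρ :=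
      lintegral_iSup'
        (fun j ↦ ((Measure.measurable_rnDeriv _ _).inf (hmeas j)).aemeasurable)
        (ae_restrict_of_ae hmono_ae)
    _ ≤ (⨆ j, μ ⊓ ν j) s := by
      refine iSup_le fun j ↦ ?_
      rw [← withDensity_apply _ hs]
      refine (le_iSup (fun i ↦ μ ⊓ ν i) j).trans' (le_inf ?_ ?_) s
      · refine (withDensity_mono (.of_forall fun x ↦ inf_le_left)).trans ?_
        rwa [Measure.withDensity_rnDeriv_eq _ _ hκρ]
      · refine (withDensity_mono (.of_forall fun x ↦ inf_le_right)).trans ?_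
        rw [hdens]
end

section
/- Let X, Y, Z be standard Borel spaces, let μ be a σ-finite measure on X × Y and ν a σ-finite measure on X × Z such that the pushforward of μ under (x,y) ↦ x equals the pushforward of ν under (x,z) ↦ x, and suppose this common marginal measure on X is σ-finite. Then there exists a measure ρ on X × Y × Z whose pushforward under (x,y,z) ↦ (x,y) is μ and whose pushforward under (x,y,z) ↦ (x,z) is ν. -/
open MeasureTheory

open ProbabilityTheory
open scoped ENNReal NNReal

/-- Densities pulled back along a measurable map commute with pushforward. -/
lemma map_withDensity_comp {α β : Type*} [MeasurableSpace α] [MeasurableSpace β]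
    (μ : Measure α) {g : α → β} (hg : Measurable g) {f : β → ℝ≥0∞} (hf : Measurable f) :
    Measure.map g (μ.withDensity fun a => f (g a)) = (Measure.map g μ).withDensity f := by
  ext s hs
  rw [Measure.map_apply hg hs, withDensity_apply _ (hg hs), withDensity_apply _ hs,
    setLIntegral_map hs hf hg]

/-- Gluing of two finite measures along a common marginal. -/
lemma exists_coupling_of_isFiniteMeasure {X Y Z : Type*}
    [MeasurableSpace X] [MeasurableSpace Y] [MeasurableSpace Z]
    [StandardBorelSpace Y] [StandardBorelSpace Z] [Nonempty Y] [Nonempty Z]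
    (μ : Measure (X × Y)) (ν : Measure (X × Z)) [IsFiniteMeasure μ] [IsFiniteMeasure ν]
    (hmarg : Measure.map Prod.fst μ = Measure.map Prod.fst ν) :
    ∃ ρ : Measure (X × Y × Z),
      Measure.map (fun p : X × Y × Z => (p.1, p.2.1)) ρ = μ ∧
      Measure.map (fun p : X × Y × Z => (p.1, p.2.2)) ρ = ν := by
  refine ⟨μ.fst ⊗ₘ (μ.condKernel ×ₖ ν.condKernel), ?_, ?_⟩
  · change Measure.map (Prod.map id Prod.fst) _ = μ
    rw [← Measure.compProd_map measurable_fst, ← Kernel.fst_eq, Kernel.fst_prod,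
      Measure.disintegrate]
  · change Measure.map (Prod.map id Prod.snd) _ = ν
    rw [← Measure.compProd_map measurable_snd, ← Kernel.snd_eq, Kernel.snd_prod,
      show μ.fst = ν.fst from hmarg, Measure.disintegrate]

/-- Gluing of two σ-finite measures along a common σ-finite marginal: if `μ` on `X × Y`
and `ν` on `X × Z` have the same pushforward to `X`, there is a measure `ρ` on
`X × Y × Z` projecting to `μ` and `ν`. -/
theorem exists_coupling_of_common_marginal
    {X Y Z : Type*} [MeasurableSpace X] [MeasurableSpace Y] [MeasurableSpace Z]
    [StandardBorelSpace X] [StandardBorelSpace Y] [StandardBorelSpace Z]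
    (μ : Measure (X × Y)) (ν : Measure (X × Z)) [SigmaFinite μ] [SigmaFinite ν]
    (hmarg : Measure.map Prod.fst μ = Measure.map Prod.fst ν)
    (hσ : SigmaFinite (Measure.map Prod.fst μ)) :
    ∃ ρ : Measure (X × Y × Z),
      Measure.map (fun p : X × Y × Z => (p.1, p.2.1)) ρ = μ ∧
      Measure.map (fun p : X × Y × Z => (p.1, p.2.2)) ρ = ν := by
  by_cases hμ : μ = 0
  · have hν : ν = 0 := by
      rw [← Measure.map_eq_zero_iff measurable_fst.aemeasurable, ← hmarg, hμ, Measure.map_zero]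
    exact ⟨0, by simp [hμ], by simp [hν]⟩
  have hν : ν ≠ 0 := fun h => hμ <| by
    rw [← Measure.map_eq_zero_iff measurable_fst.aemeasurable, hmarg, h, Measure.map_zero]
  have : Nonempty Y := by
    by_contra h
    rw [not_nonempty_iff] at h
    exact hμ (Measure.eq_zero_of_isEmpty μ)
  have : Nonempty Z := by
    by_contra h
    rw [not_nonempty_iff] at h
    exact hν (Measure.eq_zero_of_isEmpty ν)
  obtain ⟨g, hg_pos, hg, hg_int⟩ :=
    exists_pos_lintegral_lt_of_sigmaFinite (Measure.map Prod.fst μ) one_ne_zero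
  have hg' : Measurable fun x => (g x : ℝ≥0∞) := hg.coe_nnreal_ennreal
  have : IsFiniteMeasure (μ.withDensity fun p => g p.1) := by
    apply isFiniteMeasure_withDensity
    rw [lintegral_map hg' measurable_fst] at hg_int
    exact (hg_int.trans ENNReal.one_lt_top).ne
  have : IsFiniteMeasure (ν.withDensity fun p => g p.1) := by
    apply isFiniteMeasure_withDensity
    rw [hmarg, lintegral_map hg' measurable_fst] at hg_int
    exact (hg_int.trans ENNReal.one_lt_top).ne
  obtain ⟨ρ, hρμ, hρν⟩ := exists_coupling_of_isFiniteMeasure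
    (μ.withDensity fun p => g p.1) (ν.withDensity fun p => g p.1) <| by
      rw [map_withDensity_comp μ measurable_fst hg', map_withDensity_comp ν measurable_fst hg',
        hmarg]
  refine ⟨ρ.withDensity fun p => (g p.1 : ℝ≥0∞)⁻¹, ?_, ?_⟩
  · rw [map_withDensity_comp ρ (g := fun p : X × Y × Z => (p.1, p.2.1)) (by fun_prop)
      (f := fun q => (g q.1 : ℝ≥0∞)⁻¹) (hg'.comp measurable_fst).inv, hρμ]
    exact withDensity_inv_same (hg'.comp measurable_fst)
      (.of_forall fun p => by simpa using (hg_pos p.1).ne') (.of_forall fun p => by simp)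
  · rw [map_withDensity_comp ρ (g := fun p : X × Y × Z => (p.1, p.2.2)) (by fun_prop)
      (f := fun q => (g q.1 : ℝ≥0∞)⁻¹) (hg'.comp measurable_fst).inv, hρν]
    exact withDensity_inv_same (hg'.comp measurable_fst)
      (.of_forall fun p => by simpa using (hg_pos p.1).ne') (.of_forall fun p => by simp)
end
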